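/- Let G = Θ(l_1,l_2,l_3) be a Theta graph with l_1 = min_{i∈[3]} l_i ≥ 1 and l_i ≥ 2 for i ∈ {2,3}. If l_1, l_2, and l_3 all have the same parity, then for all m ≥ 3: P_DP(G,m) = (1/m)·[ (m−1)^{l_1+l_2+l_3} − (m−1)^{l_1} − (m−1)^{l_2} − (m−1)^{l_3} + 2(−1)^{l_1+l_2+l_3} ]. -/

import Mathlib

open Finset

/-- An `m`-fold cover `𝓗 = (L, H)` of `G`, represented (up to isomorphism) on the vertex set
`V × Fin m`, with `L v = {v} × Fin m`.  The fields record that each part `L v` induces a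
clique in `H`, that cross-edges occur only over edges of `G`, and that the cross-edges
between two parts form a (possibly empty) matching. -/
structure DPCover {V : Type*} (G : SimpleGraph V) (m : ℕ) where
  H : SimpleGraph (V × Fin m)
  fiber_clique : ∀ (v : V) (a b : Fin m), a ≠ b → H.Adj (v, a) (v, b)
  cross_only_edges : ∀ (u v : V) (a b : Fin m), u ≠ v → H.Adj (u, a) (v, b) → G.Adj u v
  cross_matching : ∀ (u v : V), u ≠ v → ∀ (a b b' : Fin m),
    H.Adj (u, a) (v, b) → H.Adj (u, a) (v, b') → b = b'

/-- A full `m`-fold cover: every matching between `L u` and `L v` for `uv ∈ E(G)` is perfect. -/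
def DPCover.IsFull {V : Type*} {G : SimpleGraph V} {m : ℕ} (C : DPCover G m) : Prop :=
  ∀ (u v : V), G.Adj u v → ∀ a : Fin m, ∃ b : Fin m, C.H.Adj (u, a) (v, b)

/-- `P_DP(G, 𝓗)`: the number of `𝓗`-colorings of `G`, i.e. of independent sets in `H` of size
`|V(G)|` (equivalently, of independent transversals of the parts `L v`). -/
noncomputable def DPCover.count {V : Type*} {G : SimpleGraph V} {m : ℕ} (C : DPCover G m) : ℕ :=
  Nat.card {c : V → Fin m // ∀ u v : V, u ≠ v → ¬ C.H.Adj (u, c u) (v, c v)}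

/-- The DP color function `P_DP(G, m)`: the minimum of `P_DP(G, 𝓗)` over all
`m`-fold covers `𝓗` of `G`. -/
noncomputable def PDP {V : Type*} (G : SimpleGraph V) (m : ℕ) : ℕ :=
  sInf (Set.range fun C : DPCover G m => C.count)

/-- The dual DP color function `P*_DP(G, m)`: the maximum of `P_DP(G, 𝓗)` over all full
`m`-fold covers `𝓗` of `G`. -/
noncomputable def PDPdual {V : Type*} (G : SimpleGraph V) (m : ℕ) : ℕ :=
  sSup {k : ℕ | ∃ C : DPCover G m, C.IsFull ∧ C.count = k}

/-- The chromatic polynomial `P(G, m)`: the number of proper colorings of `G` with colors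
from `{1, …, m}`. -/
noncomputable def chromP {V : Type*} (G : SimpleGraph V) (m : ℕ) : ℕ :=
  Nat.card {c : V → Fin m // ∀ u v : V, G.Adj u v → c u ≠ c v}

/-- Vertices of the generalized theta graph `Θ(l 0, …, l (n-1))`: two end vertices
`u = Sum.inl false` and `w = Sum.inl true`, and internal vertices `(i, j)` with
`j ∈ {0, …, l i - 2}` for the `i`-th path (listed along the path from `u` to `w`). -/
abbrev ThetaV {n : ℕ} (l : Fin n → ℕ) : Type :=
  Bool ⊕ (Σ i : Fin n, Fin (l i - 1))

/-- The relation generating the edges of the generalized theta graph. -/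
def thetaRel {n : ℕ} (l : Fin n → ℕ) : ThetaV l → ThetaV l → Prop
  | Sum.inl _, Sum.inl _ => ∃ i, l i = 1
  | Sum.inl a, Sum.inr ⟨i, j⟩ => (a = false ∧ (j : ℕ) = 0) ∨ (a = true ∧ (j : ℕ) = l i - 2)
  | Sum.inr _, Sum.inl _ => False
  | Sum.inr ⟨i, j⟩, Sum.inr ⟨i', j'⟩ => i = i' ∧ (j' : ℕ) = (j : ℕ) + 1

/-- The generalized theta graph `Θ(l 0, …, l (n-1))`: two end vertices `u` and `w` joined by
`n` internally disjoint paths, the `i`-th of length `l i`. -/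
def thetaGraph {n : ℕ} (l : Fin n → ℕ) : SimpleGraph (ThetaV l) :=
  SimpleGraph.fromRel (thetaRel l)

/-- The end vertex `u`. -/
def thetaU {n : ℕ} (l : Fin n → ℕ) : ThetaV l := Sum.inl false

/-- The end vertex `w`. -/
def thetaW {n : ℕ} (l : Fin n → ℕ) : ThetaV l := Sum.inl true

/-- The colors along a path with `k` internal vertices, first color `a`, internal colors `w`
and last color `b`. -/
def pathColors {M : Type*} {k : ℕ} (a b : M) (w : Fin k → M) : ℕ → M
  | 0 => a
  | j + 1 => if h : j < k then w ⟨j, h⟩ else b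

/-- The number of ways to color the `k` internal vertices of a path with end colors `a`, `b`
when the matching on the `j`-th edge is the permutation `τ j`. -/
noncomputable def pathCount {M : Type*} (k : ℕ) (τ : ℕ → Equiv.Perm M) (a b : M) : ℕ :=
  Nat.card {w : Fin k → M //
    ∀ j < k + 1, τ j (pathColors a b w j) ≠ pathColors a b w (j + 1)}

/-- The composition of the first `k + 1` permutations of a sequence. -/
def pathPerm {M : Type*} : ℕ → (ℕ → Equiv.Perm M) → Equiv.Perm M
  | 0, τ => τ 0
  | k + 1, τ => (τ 0).trans (pathPerm k fun j => τ (j + 1))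

lemma pathPerm_apply_of_succ_eq_one {M : Type*} (k : ℕ) (τ : ℕ → Equiv.Perm M)
    (h : ∀ j, τ (j + 1) = 1) : pathPerm k τ = τ 0 := by
  induction k generalizing τ with
  | zero => rfl
  | succ k ih =>
    rw [pathPerm, ih _ fun j => h (j + 1), h 0]
    rfl

lemma pathColors_cons {M : Type*} {k : ℕ} (a b c : M) (w : Fin k → M) (j : ℕ) :
    pathColors a b (Fin.cons c w : Fin (k + 1) → M) (j + 1) = pathColors c b w j := by
  cases j with
  | zero => simp [pathColors]
  | succ j =>
    by_cases h : j < k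
    · simp only [pathColors, h, Nat.add_lt_add_iff_right, dite_true]
      exact Fin.cons_succ (α := fun _ => M) c w ⟨j, h⟩
    · simp [pathColors, h]

lemma pathCount_succ {M : Type*} [Fintype M] [DecidableEq M] (k : ℕ) (τ : ℕ → Equiv.Perm M)
    (a b : M) :
    pathCount (k + 1) τ a b =
      ∑ c : M, if τ 0 a = c then 0 else pathCount k (fun j => τ (j + 1)) c b := by
  have key : ∀ (c : M) (w : Fin k → M),
      (∀ j < k + 1 + 1, τ j (pathColors a b (Fin.cons c w : Fin (k + 1) → M) j) ≠
        pathColors a b (Fin.cons c w : Fin (k + 1) → M) (j + 1)) ↔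
      τ 0 a ≠ c ∧ ∀ j < k + 1, τ (j + 1) (pathColors c b w j) ≠ pathColors c b w (j + 1) := by
    intro c w
    constructor
    · intro h
      refine ⟨by simpa [pathColors] using h 0 (by omega), fun j hj => ?_⟩
      have := h (j + 1) (by omega)
      rwa [pathColors_cons, pathColors_cons] at this
    · rintro ⟨h0, h⟩ j hj
      cases j with
      | zero => simpa [pathColors] using h0
      | succ j =>
        rw [pathColors_cons, pathColors_cons]
        exact h j (by omega)
  have e : {w : Fin (k + 1) → M //
      ∀ j < k + 1 + 1, τ j (pathColors a b w j) ≠ pathColors a b w (j + 1)} ≃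
      Σ c : M, {w : Fin k → M // τ 0 a ≠ c ∧
        ∀ j < k + 1, τ (j + 1) (pathColors c b w j) ≠ pathColors c b w (j + 1)} :=
    { toFun := fun w => ⟨w.1 0, Fin.tail w.1,
        (key (w.1 0) (Fin.tail w.1)).1 (by rw [Fin.cons_self_tail]; exact w.2)⟩
      invFun := fun x => ⟨Fin.cons x.1 x.2.1, (key x.1 x.2.1).2 x.2.2⟩
      left_inv := fun w => Subtype.ext (Fin.cons_self_tail w.1)
      right_inv := fun x => by rcases x with ⟨c, w, h⟩; rfl }
  rw [pathCount, Nat.card_congr e, Nat.card_sigma]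
  refine Finset.sum_congr rfl fun c _ => ?_
  split_ifs with h
  · simp [h]
  · simp [h, pathCount]

/-- The number of colorings of a path with `k + 1` edges whose end colors are not matched to
each other by the cover. -/
def pathBase (m : ℚ) (k : ℕ) : ℚ := ((m - 1) ^ (k + 1) - (-1) ^ (k + 1)) / m

lemma pathCount_eq {M : Type*} [Fintype M] [DecidableEq M] [Nonempty M] (k : ℕ)
    (τ : ℕ → Equiv.Perm M) (a b : M) :
    (pathCount k τ a b : ℚ) =
      pathBase (Fintype.card M) k + (-1) ^ (k + 1) * if pathPerm k τ a = b then 1 else 0 := by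
  have hm : (Fintype.card M : ℚ) ≠ 0 := by exact_mod_cast Fintype.card_ne_zero
  induction k generalizing τ a with
  | zero =>
    have hx : pathBase (Fintype.card M : ℚ) 0 = 1 := by
      rw [pathBase]
      field_simp
      ring
    rw [hx]
    by_cases h : τ 0 a = b <;> simp [pathCount, pathColors, pathPerm, h]
  | succ k ih =>
    have h1 : ∀ c : M, ((if τ 0 a = c then 0
        else pathCount k (fun j => τ (j + 1)) c b : ℕ) : ℚ) =
        (pathBase (Fintype.card M) k + (-1) ^ (k + 1) *
            if c = (pathPerm k fun j => τ (j + 1)).symm b then 1 else 0) -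
          if τ 0 a = c then (pathBase (Fintype.card M) k + (-1) ^ (k + 1) *
            if pathPerm k (fun j => τ (j + 1)) (τ 0 a) = b then 1 else 0) else 0 := by
      intro c
      split_ifs <;> simp_all [Equiv.eq_symm_apply]
    rw [pathCount_succ, Nat.cast_sum, Finset.sum_congr rfl fun c _ => h1 c,
      Finset.sum_sub_distrib, Finset.sum_add_distrib, ← Finset.mul_sum, Finset.sum_ite_eq,
      Finset.sum_ite_eq']
    simp only [Finset.sum_const, Finset.card_univ, Finset.mem_univ, if_true, nsmul_eq_mul,
      pathPerm, Equiv.trans_apply, pathBase]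
    field_simp
    ring_nf

/-- The `j`-th vertex of the `i`-th path of the generalized theta graph. -/
def thetaPath {n : ℕ} (l : Fin n → ℕ) (i : Fin n) : ℕ → ThetaV l
  | 0 => thetaU l
  | j + 1 => if h : j < l i - 1 then Sum.inr ⟨i, j, h⟩ else thetaW l

lemma apply_thetaPath {n : ℕ} {M : Type*} (l : Fin n → ℕ) (c : ThetaV l → M) (i : Fin n)
    (j : ℕ) : c (thetaPath l i j) =
      pathColors (c (thetaU l)) (c (thetaW l)) (fun k => c (Sum.inr ⟨i, k⟩)) j := by
  cases j with
  | zero => rfl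
  | succ j => by_cases h : j < l i - 1 <;> simp [thetaPath, pathColors, h]

lemma card_theta_colorings {n : ℕ} {M : Type*} [Fintype M] (l : Fin n → ℕ)
    (hl : ∀ i, 1 ≤ l i) (τ : Fin n → ℕ → Equiv.Perm M) :
    Nat.card {c : ThetaV l → M //
      ∀ i, ∀ j < l i, τ i j (c (thetaPath l i j)) ≠ c (thetaPath l i (j + 1))} =
      ∑ a : M, ∑ b : M, ∏ i, pathCount (l i - 1) (τ i) a b := by
  have e : {c : ThetaV l → M //
      ∀ i, ∀ j < l i, τ i j (c (thetaPath l i j)) ≠ c (thetaPath l i (j + 1))} ≃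
      Σ a : M, Σ b : M, ∀ i, {w : Fin (l i - 1) → M //
        ∀ j < l i - 1 + 1, τ i j (pathColors a b w j) ≠ pathColors a b w (j + 1)} :=
    { toFun := fun c => ⟨c.1 (thetaU l), c.1 (thetaW l), fun i =>
        ⟨fun k => c.1 (Sum.inr ⟨i, k⟩), fun j hj => by
          rw [← apply_thetaPath, ← apply_thetaPath]
          exact c.2 i j (by have := hl i; omega)⟩⟩
      invFun := fun x =>
        let c : ThetaV l → M := Sum.elim (fun t => bif t then x.2.1 else x.1)
          (fun p => (x.2.2 p.1).1 p.2)
        ⟨c, fun i j hj => by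
          rw [apply_thetaPath l c, apply_thetaPath l c]
          exact (x.2.2 i).2 j (by omega)⟩
      left_inv := fun c => by
        refine Subtype.ext (funext fun v => ?_)
        rcases v with (_ | _) | ⟨i, k⟩ <;> rfl
      right_inv := fun x => rfl }
  rw [Nat.card_congr e, Nat.card_sigma]
  refine Finset.sum_congr rfl fun a _ => ?_
  rw [Nat.card_sigma]
  refine Finset.sum_congr rfl fun b _ => ?_
  rw [Nat.card_pi]
  rfl

lemma exists_thetaPath_of_thetaRel {n : ℕ} {l : Fin n → ℕ} {p q : ThetaV l} (hne : p ≠ q)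
    (h : thetaRel l p q) :
    ∃ i, ∃ j < l i, (p = thetaPath l i j ∧ q = thetaPath l i (j + 1)) ∨
      (q = thetaPath l i j ∧ p = thetaPath l i (j + 1)) := by
  rcases p with a | ⟨i, j, hj⟩ <;> rcases q with b | ⟨i', j', hj'⟩
  · obtain ⟨i, hi⟩ := h
    refine ⟨i, 0, by omega, ?_⟩
    rcases a with _ | _ <;> rcases b with _ | _ <;> simp_all [thetaPath, thetaU, thetaW]
  · rcases h with ⟨rfl, h⟩ | ⟨rfl, h⟩
    · refine ⟨i', 0, by omega, Or.inl ⟨rfl, ?_⟩⟩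
      obtain rfl : j' = 0 := h
      simp [thetaPath, hj']
    · refine ⟨i', l i' - 1, by omega, Or.inr ⟨?_, ?_⟩⟩
      · obtain rfl : j' = l i' - 2 := h
        have : l i' - 1 = l i' - 2 + 1 := by omega
        refine Eq.trans ?_ (congrArg (thetaPath l i') this.symm)
        simp [thetaPath, hj']
      · simp [thetaPath, thetaW]
  · exact h.elim
  · obtain ⟨rfl, h⟩ := h
    obtain rfl : j' = j + 1 := h
    exact ⟨i, j + 1, by omega, Or.inl ⟨by simp [thetaPath, hj], by simp [thetaPath, hj']⟩⟩

lemma exists_thetaPath_of_adj {n : ℕ} {l : Fin n → ℕ} {p q : ThetaV l}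
    (h : (thetaGraph l).Adj p q) :
    ∃ i, ∃ j < l i, (p = thetaPath l i j ∧ q = thetaPath l i (j + 1)) ∨
      (q = thetaPath l i j ∧ p = thetaPath l i (j + 1)) := by
  obtain ⟨hne, h | h⟩ := (SimpleGraph.fromRel_adj _ _ _).1 h
  · exact exists_thetaPath_of_thetaRel hne h
  · obtain ⟨i, j, hj, h⟩ := exists_thetaPath_of_thetaRel hne.symm h
    exact ⟨i, j, hj, h.symm⟩

lemma thetaGraph_adj_thetaPath {n : ℕ} (l : Fin n → ℕ) (i : Fin n) {j : ℕ} (hj : j < l i) :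
    (thetaGraph l).Adj (thetaPath l i j) (thetaPath l i (j + 1)) := by
  rw [thetaGraph, SimpleGraph.fromRel_adj]
  cases j with
  | zero =>
    by_cases h : 0 < l i - 1
    · simp [thetaPath, h, thetaU, thetaRel]
    · simp only [thetaPath, h, thetaU, thetaW, thetaRel, dite_false]
      exact ⟨by simp, Or.inl ⟨i, by omega⟩⟩
  | succ j =>
    have h0 : j < l i - 1 := by omega
    by_cases h : j + 1 < l i - 1
    · simp [thetaPath, h, h0, thetaRel]
    · simp only [thetaPath, h, h0, thetaW, thetaRel, dite_true, dite_false]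
      exact ⟨by simp, Or.inr (Or.inr ⟨trivial, by omega⟩)⟩

lemma DPCover.exists_perm {V : Type*} {G : SimpleGraph V} {m : ℕ} (C : DPCover G m) {p q : V}
    (hne : p ≠ q) : ∃ σ : Equiv.Perm (Fin m), ∀ a b, C.H.Adj (p, a) (q, b) → σ a = b := by
  classical
  let f : Fin m → Fin m := fun a => if h : ∃ b, C.H.Adj (p, a) (q, b) then h.choose else a
  have hf : ∀ a, (∃ b, C.H.Adj (p, a) (q, b)) → C.H.Adj (p, a) (q, f a) := by
    intro a h
    simp only [f, dif_pos h]
    exact h.choose_spec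
  let s : Finset (Fin m) := Finset.univ.filter fun a => ∃ b, C.H.Adj (p, a) (q, b)
  have hs : ∀ a ∈ s, C.H.Adj (p, a) (q, f a) := fun a ha => hf a (Finset.mem_filter.1 ha).2
  have hinj : Set.InjOn f s := by
    intro a ha a' ha' h
    have h1 := hs a ha
    have h2 := hs a' ha'
    rw [← h] at h2
    exact C.cross_matching q p hne.symm (f a) a a' h1.symm h2.symm
  obtain ⟨g, hg⟩ := Finset.exists_equiv_extend_of_card_eq (t := (Finset.univ : Finset (Fin m)))
    (by simp) (s := s) (f := f) (Finset.subset_univ _) hinj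
  refine ⟨g.trans (Equiv.subtypeUnivEquiv fun x => Finset.mem_univ x), fun a b hab => ?_⟩
  have := hg a (Finset.mem_filter.2 ⟨Finset.mem_univ _, b, hab⟩)
  simp only [Equiv.trans_apply, Equiv.subtypeUnivEquiv_apply, this]
  exact C.cross_matching p q hne a _ _ (hf a ⟨b, hab⟩) hab

lemma DPCover.exists_le_count_theta {n m : ℕ} {l : Fin n → ℕ} (hl : ∀ i, 1 ≤ l i)
    (C : DPCover (thetaGraph l) m) : ∃ τ : Fin n → ℕ → Equiv.Perm (Fin m),
      ∑ a, ∑ b, ∏ i, pathCount (l i - 1) (τ i) a b ≤ C.count := by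
  have h : ∀ i j, ∃ σ : Equiv.Perm (Fin m), j < l i → ∀ a b,
      C.H.Adj (thetaPath l i j, a) (thetaPath l i (j + 1), b) → σ a = b := by
    intro i j
    by_cases hj : j < l i
    · obtain ⟨σ, hσ⟩ := C.exists_perm (thetaGraph_adj_thetaPath l i hj).ne
      exact ⟨σ, fun _ => hσ⟩
    · exact ⟨1, fun h => absurd h hj⟩
  choose τ hτ using h
  refine ⟨τ, ?_⟩
  rw [← card_theta_colorings l hl τ, DPCover.count]
  refine Nat.card_le_card_of_injective (Subtype.map id fun c hc u v huv hadj => ?_)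
    (Subtype.map_injective _ Function.injective_id)
  obtain ⟨i, j, hj, ⟨rfl, rfl⟩ | ⟨rfl, rfl⟩⟩ :=
    exists_thetaPath_of_adj (C.cross_only_edges _ _ _ _ huv hadj)
  · exact hc i j hj (hτ i j hj _ _ hadj)
  · exact hc i j hj (hτ i j hj _ _ hadj.symm)

/-- The cover of `G` in which the matching between `L u` and `L v` is the shift by `d u v`. -/
def shiftCover {V : Type*} (G : SimpleGraph V) {m : ℕ} [NeZero m] (d : V → V → Fin m)
    (hd : ∀ u v, d v u = -d u v) : DPCover G m where
  H :=
    { Adj := fun x y => (x.1 = y.1 ∧ x.2 ≠ y.2) ∨ (G.Adj x.1 y.1 ∧ x.2 + d x.1 y.1 = y.2)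
      symm := ⟨by
        rintro ⟨u, a⟩ ⟨v, b⟩ (⟨h, h'⟩ | ⟨h, h'⟩)
        · exact Or.inl ⟨h.symm, h'.symm⟩
        · refine Or.inr ⟨h.symm, ?_⟩
          dsimp only at h' ⊢
          rw [← h', hd u v, add_neg_cancel_right]⟩
      loopless := ⟨by
        rintro ⟨u, a⟩ (⟨_, h⟩ | ⟨h, _⟩)
        · exact h rfl
        · exact G.loopless.irrefl _ h⟩ }
  fiber_clique := fun v a b h => Or.inl ⟨rfl, h⟩
  cross_only_edges := by
    rintro u v a b huv (⟨h, _⟩ | ⟨h, _⟩)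
    · exact absurd h huv
    · exact h
  cross_matching := by
    rintro u v huv a b b' (⟨h, _⟩ | ⟨_, h⟩) (⟨h', _⟩ | ⟨_, h'⟩)
    · exact absurd h huv
    · exact absurd h huv
    · exact absurd h' huv
    · exact h.symm.trans h'

lemma count_shiftCover_theta {n m : ℕ} [NeZero m] {l : Fin n → ℕ} (hl : ∀ i, 1 ≤ l i)
    (d : ThetaV l → ThetaV l → Fin m) (hd : ∀ u v, d v u = -d u v) :
    (shiftCover (thetaGraph l) d hd).count = ∑ a, ∑ b, ∏ i, pathCount (l i - 1)
      (fun j => Equiv.addRight (d (thetaPath l i j) (thetaPath l i (j + 1)))) a b := by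
  rw [← card_theta_colorings l hl, DPCover.count]
  refine Nat.card_congr (Equiv.subtypeEquivRight fun c => ⟨fun h i j hj hc => ?_, ?_⟩)
  · have hadj := thetaGraph_adj_thetaPath l i hj
    exact h _ _ hadj.ne (Or.inr ⟨hadj, hc⟩)
  · rintro hc u v huv hadj
    obtain ⟨i, j, hj, ⟨rfl, rfl⟩ | ⟨rfl, rfl⟩⟩ :=
      exists_thetaPath_of_adj ((shiftCover _ d hd).cross_only_edges _ _ _ _ huv hadj)
    · rcases hadj with ⟨h, _⟩ | ⟨_, h⟩
      · exact huv h
      · exact hc i j hj h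
    · rcases hadj.symm with ⟨h, _⟩ | ⟨_, h⟩
      · exact huv h.symm
      · exact hc i j hj h

/-- Shifts on the directed edges of a theta graph: the edge from `u` to the first internal vertex
of the `i`-th path is shifted by `i`, and all other edges by `0`. -/
def firstEdgeShift {n : ℕ} (l : Fin n → ℕ) (m : ℕ) [NeZero m] : ThetaV l → ThetaV l → Fin m
  | Sum.inl false, Sum.inr ⟨i, j⟩ => if (j : ℕ) = 0 then Fin.ofNat m i else 0
  | _, _ => 0

lemma exists_cover_theta_count {m : ℕ} [NeZero m] {l : Fin 3 → ℕ} (hl1 : 1 ≤ l 0)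
    (hl2 : 2 ≤ l 1) (hl3 : 2 ≤ l 2) : ∃ (C : DPCover (thetaGraph l) m)
      (τ : Fin 3 → ℕ → Equiv.Perm (Fin m)),
      C.count = ∑ a, ∑ b, ∏ i, pathCount (l i - 1) (τ i) a b ∧
      ∀ i, pathPerm (l i - 1) (τ i) = Equiv.addRight (Fin.ofNat m i) := by
  have hl : ∀ i, 1 ≤ l i := by
    intro i
    fin_cases i
    exacts [hl1, by simp; omega, by simp; omega]
  let e := firstEdgeShift l m
  refine ⟨shiftCover _ (fun u v => e u v - e v u) fun u v => (neg_sub _ _).symm, _,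
    count_shiftCover_theta hl _ _, fun i => ?_⟩
  have hW : ∀ v, e (thetaW l) v = 0 := by rintro ((_ | _) | _) <;> rfl
  have hW' : ∀ v, e v (thetaW l) = 0 := by rintro ((_ | _) | _) <;> rfl
  have hR : ∀ x v, e (Sum.inr x) v = 0 := by rintro x ((_ | _) | _) <;> rfl
  rw [pathPerm_apply_of_succ_eq_one]
  · congr 1
    by_cases h : 0 < l i - 1
    · simp only [thetaPath, h, dite_true, hR, sub_zero]
      rfl
    · have hi : i = 0 := by
        fin_cases i
        · rfl
        · simp at h; omega
        · simp at h; omega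
      simp only [thetaPath, h, dite_false, hW, hW', sub_zero]
      subst hi
      rfl
  · intro j
    by_cases h0 : j < l i - 1 <;> by_cases h : j + 1 < l i - 1 <;>
      simp [thetaPath, h, h0, hW, hW', hR]

lemma pathBase_nonneg {m : ℚ} (hm : 2 ≤ m) (k : ℕ) : 0 ≤ pathBase m k := by
  refine div_nonneg ?_ (by linarith)
  have h1 : (1 : ℚ) ≤ (m - 1) ^ (k + 1) := one_le_pow₀ (by linarith)
  rcases neg_one_pow_eq_or ℚ (k + 1) with h | h <;> rw [h] <;> linarith

lemma one_le_pathBase {m : ℚ} (hm : 2 ≤ m) {k : ℕ} (hk : (-1 : ℚ) ^ (k + 1) = -1) :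
    1 ≤ pathBase m k := by
  rw [pathBase, hk, le_div_iff₀ (by linarith)]
  have : m - 1 ≤ (m - 1) ^ (k + 1) := le_self_pow₀ (by linarith) (by omega)
  linarith

lemma sum_sum_ite_perm {M : Type*} [Fintype M] [DecidableEq M] (σ : Equiv.Perm M) :
    ∑ a, ∑ b, (if σ a = b then (1 : ℚ) else 0) = Fintype.card M := by
  simp

lemma sum_sum_linear {M : Type*} [Fintype M] [DecidableEq M] (σ : Fin 3 → Equiv.Perm M)
    (A B₀ B₁ B₂ : ℚ) :
    ∑ a, ∑ b, (A + B₀ * (if σ 0 a = b then 1 else 0) + B₁ * (if σ 1 a = b then 1 else 0) +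
      B₂ * (if σ 2 a = b then 1 else 0)) =
      (Fintype.card M : ℚ) ^ 2 * A + Fintype.card M * (B₀ + B₁ + B₂) := by
  simp only [Finset.sum_add_distrib, ← Finset.mul_sum, sum_sum_ite_perm]
  simp
  ring

lemma linear_le_prod_three {x₀ x₁ x₂ s e₀ e₁ e₂ : ℚ} (hx₀ : 0 ≤ x₀) (hx₁ : 0 ≤ x₁)
    (hx₂ : 0 ≤ x₂) (hs : s = 1 ∨ s = -1 ∧ 1 ≤ x₀) (he₀ : e₀ = 0 ∨ e₀ = 1)
    (he₁ : e₁ = 0 ∨ e₁ = 1) (he₂ : e₂ = 0 ∨ e₂ = 1) :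
    x₀ * x₁ * x₂ + s * x₁ * x₂ * e₀ + s * x₀ * x₂ * e₁ + s * x₀ * x₁ * e₂ ≤
      (x₀ + s * e₀) * (x₁ + s * e₁) * (x₂ + s * e₂) := by
  rw [← sub_nonneg]
  have h : (x₀ + s * e₀) * (x₁ + s * e₁) * (x₂ + s * e₂) -
      (x₀ * x₁ * x₂ + s * x₁ * x₂ * e₀ + s * x₀ * x₂ * e₁ + s * x₀ * x₁ * e₂) =
      s ^ 2 * (x₀ * (e₁ * e₂) + x₁ * (e₀ * e₂) + x₂ * (e₀ * e₁) + s * (e₀ * e₁ * e₂)) := by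
    ring
  rw [h]
  refine mul_nonneg (sq_nonneg s) ?_
  rcases he₀ with rfl | rfl <;> rcases he₁ with rfl | rfl <;> rcases he₂ with rfl | rfl <;>
    rcases hs with rfl | ⟨rfl, hs⟩ <;> linarith

lemma prod_three_eq_linear {x₀ x₁ x₂ s e₀ e₁ e₂ : ℚ} (h₀₁ : e₀ * e₁ = 0) (h₀₂ : e₀ * e₂ = 0)
    (h₁₂ : e₁ * e₂ = 0) :
    (x₀ + s * e₀) * (x₁ + s * e₁) * (x₂ + s * e₂) =
      x₀ * x₁ * x₂ + s * x₁ * x₂ * e₀ + s * x₀ * x₂ * e₁ + s * x₀ * x₁ * e₂ := by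
  linear_combination s ^ 2 * x₂ * h₀₁ + s ^ 2 * x₁ * h₀₂ + s ^ 2 * x₀ * h₁₂ + s ^ 3 * e₂ * h₀₁

/-- Let `G = Θ(l_1,l_2,l_3)` with `l_1 = min l_i ≥ 1` and `l_2, l_3 ≥ 2`.
If `l_1`, `l_2`, `l_3` all have the same parity, then for all `m ≥ 3`:
`P_DP(G,m) = (1/m)·[(m−1)^{l_1+l_2+l_3} − (m−1)^{l_1} − (m−1)^{l_2} − (m−1)^{l_3}
  + 2(−1)^{l_1+l_2+l_3}]`. -/
theorem statement7 (l : Fin 3 → ℕ)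
    (hmin : ∀ i : Fin 3, l 0 ≤ l i) (hl1 : 1 ≤ l 0) (hl2 : 2 ≤ l 1) (hl3 : 2 ≤ l 2)
    (hpar2 : l 0 % 2 = l 1 % 2) (hpar3 : l 0 % 2 = l 2 % 2) :
    ∀ m : ℕ, 3 ≤ m →
      (PDP (thetaGraph l) m : ℚ) =
        (1 / (m : ℚ)) *
          (((m : ℚ) - 1) ^ (l 0 + l 1 + l 2) - ((m : ℚ) - 1) ^ (l 0) - ((m : ℚ) - 1) ^ (l 1) -
            ((m : ℚ) - 1) ^ (l 2) + 2 * (-1 : ℚ) ^ (l 0 + l 1 + l 2)) := by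
  intro m hm
  have : NeZero m := ⟨by omega⟩
  have hm0 : (m : ℚ) ≠ 0 := by exact_mod_cast (by omega : m ≠ 0)
  have hm2 : (2 : ℚ) ≤ m := by exact_mod_cast (by omega : 2 ≤ m)
  have hl : ∀ i, 1 ≤ l i := fun i => hl1.trans (hmin i)
  obtain ⟨s, hs, hs'⟩ : ∃ s : ℚ, (s = 1 ∨ s = -1) ∧ ∀ i, (-1 : ℚ) ^ l i = s := by
    refine ⟨(-1) ^ l 0, neg_one_pow_eq_or ℚ _, fun i => ?_⟩
    have : l i % 2 = l 0 % 2 := by fin_cases i; exacts [rfl, hpar2.symm, hpar3.symm]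
    rw [neg_one_pow_eq_pow_mod_two, this, ← neg_one_pow_eq_pow_mod_two]
  have hsucc : ∀ i, l i - 1 + 1 = l i := fun i => Nat.sub_add_cancel (hl i)
  have hx0 : ∀ i, 0 ≤ pathBase m (l i - 1) := fun i => pathBase_nonneg hm2 _
  have hx1 : s = -1 → ∀ i, 1 ≤ pathBase m (l i - 1) := fun h i =>
    one_le_pathBase hm2 (by rw [hsucc, hs', h])
  have hcount : ∀ τ : Fin 3 → ℕ → Equiv.Perm (Fin m),
      ((∑ a, ∑ b, ∏ i, pathCount (l i - 1) (τ i) a b : ℕ) : ℚ) = ∑ a, ∑ b, ∏ i,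
        (pathBase m (l i - 1) + s * if pathPerm (l i - 1) (τ i) a = b then 1 else 0) := by
    intro τ
    push_cast
    simp only [pathCount_eq, hsucc, hs', Fintype.card_fin]
  have hval : (m : ℚ) ^ 2 *
        (pathBase m (l 0 - 1) * pathBase m (l 1 - 1) * pathBase m (l 2 - 1)) +
      m * (s * pathBase m (l 1 - 1) * pathBase m (l 2 - 1) +
        s * pathBase m (l 0 - 1) * pathBase m (l 2 - 1) +
        s * pathBase m (l 0 - 1) * pathBase m (l 1 - 1)) =
      (1 / (m : ℚ)) *
          (((m : ℚ) - 1) ^ (l 0 + l 1 + l 2) - ((m : ℚ) - 1) ^ (l 0) - ((m : ℚ) - 1) ^ (l 1) -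
            ((m : ℚ) - 1) ^ (l 2) + 2 * (-1 : ℚ) ^ (l 0 + l 1 + l 2)) := by
    simp only [pathBase, hsucc, pow_add, hs']
    generalize ((m : ℚ) - 1) ^ l 0 = y₀
    generalize ((m : ℚ) - 1) ^ l 1 = y₁
    generalize ((m : ℚ) - 1) ^ l 2 = y₂
    rcases hs with rfl | rfl <;> field_simp <;> ring
  rw [← hval]
  apply le_antisymm
  · obtain ⟨C, τ, hC, hτ⟩ := exists_cover_theta_count (m := m) hl1 hl2 hl3
    have hle : (PDP (thetaGraph l) m : ℚ) ≤ C.count := by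
      exact_mod_cast Nat.sInf_le (Set.mem_range_self C)
    refine hle.trans (le_of_eq ?_)
    have hlin := sum_sum_linear (fun i : Fin 3 => pathPerm (l i - 1) (τ i))
      (pathBase m (l 0 - 1) * pathBase m (l 1 - 1) * pathBase m (l 2 - 1))
      (s * pathBase m (l 1 - 1) * pathBase m (l 2 - 1))
      (s * pathBase m (l 0 - 1) * pathBase m (l 2 - 1))
      (s * pathBase m (l 0 - 1) * pathBase m (l 1 - 1))
    rw [Fintype.card_fin] at hlin
    rw [hC, hcount, ← hlin]
    refine Finset.sum_congr rfl fun a _ => Finset.sum_congr rfl fun b _ => ?_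
    have hdis : ∀ i j : Fin 3, i ≠ j →
        (if pathPerm (l i - 1) (τ i) a = b then (1 : ℚ) else 0) *
          (if pathPerm (l j - 1) (τ j) a = b then 1 else 0) = 0 := by
      intro i j hij
      rw [mul_eq_zero, ite_eq_right_iff, ite_eq_right_iff]
      by_contra! hcon
      obtain ⟨⟨hi, _⟩, hj, _⟩ := hcon
      rw [hτ] at hi hj
      have h := add_left_cancel (hi.trans hj.symm)
      have h' := congrArg Fin.val h
      change (i : ℕ) % m = (j : ℕ) % m at h'
      rw [Nat.mod_eq_of_lt (by omega), Nat.mod_eq_of_lt (by omega)] at h'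
      exact hij (Fin.ext h')
    rw [Fin.prod_univ_three]
    exact prod_three_eq_linear (hdis 0 1 (by decide)) (hdis 0 2 (by decide))
      (hdis 1 2 (by decide))
  · obtain ⟨C, hC⟩ : PDP (thetaGraph l) m ∈
        Set.range fun C : DPCover (thetaGraph l) m => C.count :=
      Nat.sInf_mem ⟨_, shiftCover _ (fun _ _ => 0) (fun _ _ => neg_zero.symm), rfl⟩
    obtain ⟨τ, hτ⟩ := C.exists_le_count_theta hl
    have hle : ((∑ a, ∑ b, ∏ i, pathCount (l i - 1) (τ i) a b : ℕ) : ℚ) ≤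
        PDP (thetaGraph l) m := by
      rw [← hC]
      exact_mod_cast hτ
    refine le_trans ?_ hle
    have hlin := sum_sum_linear (fun i : Fin 3 => pathPerm (l i - 1) (τ i))
      (pathBase m (l 0 - 1) * pathBase m (l 1 - 1) * pathBase m (l 2 - 1))
      (s * pathBase m (l 1 - 1) * pathBase m (l 2 - 1))
      (s * pathBase m (l 0 - 1) * pathBase m (l 2 - 1))
      (s * pathBase m (l 0 - 1) * pathBase m (l 1 - 1))
    rw [Fintype.card_fin] at hlin
    rw [hcount, ← hlin]
    refine Finset.sum_le_sum fun a _ => Finset.sum_le_sum fun b _ => ?_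
    rw [Fin.prod_univ_three]
    exact linear_le_prod_three (hx0 0) (hx0 1) (hx0 2) (hs.imp_right fun h => ⟨h, hx1 h 0⟩)
      (ite_eq_or_eq _ _ _).symm (ite_eq_or_eq _ _ _).symm (ite_eq_or_eq _ _ _).symm
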